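/- arXiv:1004.0101 — 4 statements merged into one kernel-verified Lean document; each statement's English description precedes it below -/
import Mathlib

section
/- Let m > 0 and e be real constants, let φ : ℝ × ℝ³ → ℝ be smooth, and set h(t, q, p) = |p|²/(2m) + e·φ(t, q). Suppose the components Π_i, Πⁱ (i = 1,2,3) of a time-dependent momentum one-form are smooth functions on ℝ × (ℝ³ × ℝ³) satisfying the momentum-Vlasov equations ∂Π_i/∂t = −X_h(Π_i) + e·Σ_j (∂²φ/∂q_i∂q_j)·Πʲ and ∂Πⁱ/∂t = −X_h(Πⁱ) − (1/m)·Π_i for all (t, z). Then the plasma density f(t, z) = Σ_i (∂Π_i/∂p_i − ∂Πⁱ/∂q_i) satisfies the Vlasov equation ∂f/∂t + Σ_i (p_i/m)·∂f/∂q_i − e·Σ_i (∂φ/∂q_i)·∂f/∂p_i = 0. -/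
open MeasureTheory

noncomputable section

/-- Position/momentum 3-space. -/
abbrev V3 : Type := Fin 3 → ℝ

/-- Phase space `ℝ³ × ℝ³` with coordinates `z = (q, p)`. -/
abbrev Phase : Type := V3 × V3

/-- Partial derivative in the `i`-th position variable `q i`. -/
def pq (i : Fin 3) (F : Phase → ℝ) (z : Phase) : ℝ :=
  deriv (fun s => F (Function.update z.1 i s, z.2)) (z.1 i)

/-- Partial derivative in the `i`-th momentum variable `p i`. -/
def pp (i : Fin 3) (F : Phase → ℝ) (z : Phase) : ℝ :=
  deriv (fun s => F (z.1, Function.update z.2 i s)) (z.2 i)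

/-- Partial derivative of a function on `ℝ³`. -/
def dq3 (i : Fin 3) (g : V3 → ℝ) (q : V3) : ℝ :=
  deriv (fun s => g (Function.update q i s)) (q i)

/-- Action of the Hamiltonian vector field of `a` on the function `F`:
`X_a(F) = Σᵢ (∂a/∂pᵢ ∂F/∂qᵢ − ∂a/∂qᵢ ∂F/∂pᵢ)`. -/
def Xact (a F : Phase → ℝ) (z : Phase) : ℝ :=
  ∑ i : Fin 3, (pp i a z * pq i F z - pq i a z * pp i F z)
/-- Directional derivative of `F` in the direction `v`. -/
def dirDeriv {E : Type*} [NormedAddCommGroup E] [NormedSpace ℝ E] (v : E) (F : E → ℝ) (x : E) : ℝ :=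
  fderiv ℝ F x v

section DirDeriv

variable {E : Type*} [NormedAddCommGroup E] [NormedSpace ℝ E] {F G : E → ℝ}

theorem ContDiff.dirDeriv (hF : ContDiff ℝ (⊤ : ℕ∞) F) (v : E) :
    ContDiff ℝ (⊤ : ℕ∞) (dirDeriv v F) :=
  (hF.fderiv_right (m := (⊤ : ℕ∞)) (by exact_mod_cast le_top)).clm_apply contDiff_const

theorem dirDeriv_comm (hF : ContDiff ℝ (⊤ : ℕ∞) F) (v w : E) (x : E) :
    dirDeriv v (dirDeriv w F) x = dirDeriv w (dirDeriv v F) x := by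
  have hd : DifferentiableAt ℝ (fderiv ℝ F) x :=
    ((hF.fderiv_right (m := (⊤ : ℕ∞)) (by exact_mod_cast le_top)).differentiable
      (by simp)).differentiableAt
  have key (a b : E) : dirDeriv a (dirDeriv b F) x = fderiv ℝ (fderiv ℝ F) x a b := by
    have := (hd.hasFDerivAt.clm_apply (hasFDerivAt_const b x)).fderiv
    simp only [dirDeriv]
    change fderiv ℝ (fun y => fderiv ℝ F y b) x a = _
    rw [this]
    simp
  have hs : IsSymmSndFDerivAt ℝ F x := hF.contDiffAt.isSymmSndFDerivAt (by
    rw [minSmoothness_of_isRCLikeNormedField]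
    exact WithTop.coe_le_coe.2 (le_top : (2 : ℕ∞) ≤ ⊤))
  rw [key, key, hs.eq]

theorem dirDeriv_add (v x : E) (hF : DifferentiableAt ℝ F x) (hG : DifferentiableAt ℝ G x) :
    dirDeriv v (fun y => F y + G y) x = dirDeriv v F x + dirDeriv v G x := by
  simp [dirDeriv, fderiv_fun_add hF hG]

theorem dirDeriv_sub (v x : E) (hF : DifferentiableAt ℝ F x) (hG : DifferentiableAt ℝ G x) :
    dirDeriv v (fun y => F y - G y) x = dirDeriv v F x - dirDeriv v G x := by
  simp [dirDeriv, fderiv_fun_sub hF hG]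

theorem dirDeriv_neg (v x : E) :
    dirDeriv v (fun y => -F y) x = -dirDeriv v F x := by
  simp [dirDeriv, fderiv_fun_neg]

theorem dirDeriv_mul (v x : E) (hF : DifferentiableAt ℝ F x) (hG : DifferentiableAt ℝ G x) :
    dirDeriv v (fun y => F y * G y) x = dirDeriv v F x * G x + F x * dirDeriv v G x := by
  simp [dirDeriv, fderiv_fun_mul hF hG]; ring

theorem dirDeriv_const_mul (c : ℝ) (v x : E) (hF : DifferentiableAt ℝ F x) :
    dirDeriv v (fun y => c * F y) x = c * dirDeriv v F x := by
  simp [dirDeriv, fderiv_const_mul hF]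

theorem dirDeriv_sum {ι : Type*} (s : Finset ι) {F : ι → E → ℝ} (v x : E)
    (hF : ∀ i ∈ s, DifferentiableAt ℝ (F i) x) :
    dirDeriv v (fun y => ∑ i ∈ s, F i y) x = ∑ i ∈ s, dirDeriv v (F i) x := by
  simp [dirDeriv, fderiv_fun_sum hF]

theorem deriv_comp_eq_dirDeriv {c : ℝ → E} {v : E} {s : ℝ} (hF : ContDiff ℝ (⊤ : ℕ∞) F)
    (hc : HasDerivAt c v s) : deriv (fun r => F (c r)) s = dirDeriv v F (c s) :=
  (((hF.differentiable (by simp)) (c s)).hasFDerivAt.comp_hasDerivAt s hc).deriv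

end DirDeriv

/-- The time direction in extended phase space. -/
def timeDir : ℝ × Phase := (1, (0, 0))

/-- The `i`-th position direction in extended phase space. -/
def posDir (i : Fin 3) : ℝ × Phase := (0, (Pi.single i 1, 0))

/-- The `i`-th momentum direction in extended phase space. -/
def momDir (i : Fin 3) : ℝ × Phase := (0, (0, Pi.single i 1))

theorem deriv_time_eq_dirDeriv {F : ℝ → Phase → ℝ}
    (hF : ContDiff ℝ (⊤ : ℕ∞) (fun x : ℝ × Phase => F x.1 x.2)) (t : ℝ) (z : Phase) :
    deriv (fun s => F s z) t = dirDeriv timeDir (fun x : ℝ × Phase => F x.1 x.2) (t, z) :=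
  deriv_comp_eq_dirDeriv (c := fun s => (s, z)) hF
    ((hasDerivAt_id t).prodMk (hasDerivAt_const t z))

theorem pq_eq_dirDeriv {F : ℝ → Phase → ℝ}
    (hF : ContDiff ℝ (⊤ : ℕ∞) (fun x : ℝ × Phase => F x.1 x.2)) (i : Fin 3) (t : ℝ) (z : Phase) :
    pq i (F t) z = dirDeriv (posDir i) (fun x : ℝ × Phase => F x.1 x.2) (t, z) := by
  have := deriv_comp_eq_dirDeriv (c := fun s => (t, (Function.update z.1 i s, z.2))) hF
    ((hasDerivAt_const (z.1 i) t).prodMk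
      ((hasDerivAt_update z.1 i (z.1 i)).prodMk (hasDerivAt_const (z.1 i) z.2)))
  simpa [pq, posDir] using this

theorem pp_eq_dirDeriv {F : ℝ → Phase → ℝ}
    (hF : ContDiff ℝ (⊤ : ℕ∞) (fun x : ℝ × Phase => F x.1 x.2)) (i : Fin 3) (t : ℝ) (z : Phase) :
    pp i (F t) z = dirDeriv (momDir i) (fun x : ℝ × Phase => F x.1 x.2) (t, z) := by
  have := deriv_comp_eq_dirDeriv (c := fun s => (t, (z.1, Function.update z.2 i s))) hF
    ((hasDerivAt_const (z.2 i) t).prodMk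
      ((hasDerivAt_const (z.2 i) z.1).prodMk (hasDerivAt_update z.2 i (z.2 i))))
  simpa [pp, momDir] using this

theorem contDiff_momentum (j : Fin 3) :
    ContDiff ℝ (⊤ : ℕ∞) (fun x : ℝ × Phase => x.2.2 j) := by fun_prop

theorem dirDeriv_momentum (v : ℝ × Phase) (j : Fin 3) (x : ℝ × Phase) :
    dirDeriv v (fun y : ℝ × Phase => y.2.2 j) x = v.2.2 j :=
  congrArg (fun L => L v) ((ContinuousLinearMap.proj (R := ℝ) (φ := fun _ : Fin 3 => ℝ) j).comp
    ((ContinuousLinearMap.snd ℝ V3 V3).comp (ContinuousLinearMap.snd ℝ ℝ Phase))).fderiv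

/-- The Hamiltonian vector field of `|p|²/(2m) + eΦ` acting on `G`, with `Φ` a potential on
extended phase space. -/
def vlasovField (m e : ℝ) (Φ G : ℝ × Phase → ℝ) (x : ℝ × Phase) : ℝ :=
  ∑ j : Fin 3, ((1 / m) * (x.2.2 j * dirDeriv (posDir j) G x)
    - e * (dirDeriv (posDir j) Φ x * dirDeriv (momDir j) G x))

theorem ContDiff.vlasovField {m e : ℝ} {Φ G : ℝ × Phase → ℝ} (hΦ : ContDiff ℝ (⊤ : ℕ∞) Φ)
    (hG : ContDiff ℝ (⊤ : ℕ∞) G) : ContDiff ℝ (⊤ : ℕ∞) (vlasovField m e Φ G) :=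
  ContDiff.sum fun j _ =>
    (contDiff_const.mul ((contDiff_momentum j).mul (hG.dirDeriv _))).sub
      (contDiff_const.mul ((hΦ.dirDeriv _).mul (hG.dirDeriv _)))

/-- Commutator of the Hamiltonian vector field with a constant direction. -/
theorem dirDeriv_vlasovField {m e : ℝ} {Φ G : ℝ × Phase → ℝ} (hΦ : ContDiff ℝ (⊤ : ℕ∞) Φ)
    (hG : ContDiff ℝ (⊤ : ℕ∞) G) (v x : ℝ × Phase) :
    dirDeriv v (vlasovField m e Φ G) x = vlasovField m e Φ (dirDeriv v G) x
      + ∑ j : Fin 3, ((1 / m) * (v.2.2 j * dirDeriv (posDir j) G x)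
        - e * (dirDeriv v (dirDeriv (posDir j) Φ) x * dirDeriv (momDir j) G x)) := by
  have d {F : ℝ × Phase → ℝ} (hF : ContDiff ℝ (⊤ : ℕ∞) F) : DifferentiableAt ℝ F x :=
    (hF.differentiable (by simp)) x
  have h₁ (j : Fin 3) := (contDiff_momentum j).mul (hG.dirDeriv (posDir j))
  have h₂ (j : Fin 3) := (hΦ.dirDeriv (posDir j)).mul (hG.dirDeriv (momDir j))
  unfold vlasovField
  rw [dirDeriv_sum _ _ _ fun j _ =>
    d ((contDiff_const.mul (h₁ j)).sub (contDiff_const.mul (h₂ j))), ← Finset.sum_add_distrib]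
  refine Finset.sum_congr rfl fun j _ => ?_
  rw [dirDeriv_sub _ _ (d (contDiff_const.mul (h₁ j))) (d (contDiff_const.mul (h₂ j))),
    dirDeriv_const_mul _ _ _ (d (h₁ j)), dirDeriv_const_mul _ _ _ (d (h₂ j)),
    dirDeriv_mul _ _ (d (contDiff_momentum j)) (d (hG.dirDeriv _)),
    dirDeriv_mul _ _ (d (hΦ.dirDeriv _)) (d (hG.dirDeriv _)), dirDeriv_momentum,
    dirDeriv_comm hG v (posDir j), dirDeriv_comm hG v (momDir j)]
  ring

theorem dq3_eq_dirDeriv {g : ℝ → V3 → ℝ}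
    (hg : ContDiff ℝ (⊤ : ℕ∞) (fun x : ℝ × V3 => g x.1 x.2)) (i : Fin 3) (t : ℝ) (z : Phase) :
    dq3 i (g t) z.1 = dirDeriv (posDir i) (fun x : ℝ × Phase => g x.1 x.2.1) (t, z) :=
  pq_eq_dirDeriv (F := fun t z => g t z.1)
    (hg.comp (contDiff_fst.prodMk (contDiff_fst.comp contDiff_snd))) i t z

theorem contDiff_dq3 {g : ℝ → V3 → ℝ}
    (hg : ContDiff ℝ (⊤ : ℕ∞) (fun x : ℝ × V3 => g x.1 x.2)) (i : Fin 3) :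
    ContDiff ℝ (⊤ : ℕ∞) (fun x : ℝ × V3 => dq3 i (g x.1) x.2) := by
  have hG : ContDiff ℝ (⊤ : ℕ∞) (fun x : ℝ × Phase => g x.1 x.2.1) :=
    hg.comp (contDiff_fst.prodMk (contDiff_fst.comp contDiff_snd))
  have : (fun x : ℝ × V3 => dq3 i (g x.1) x.2) = fun x : ℝ × V3 =>
      dirDeriv (posDir i) (fun x : ℝ × Phase => g x.1 x.2.1) (x.1, (x.2, 0)) :=
    funext fun x => dq3_eq_dirDeriv hg i x.1 (x.2, 0)
  rw [this]
  exact (hG.dirDeriv _).comp (contDiff_fst.prodMk (contDiff_snd.prodMk contDiff_const))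

theorem dirDeriv_momDir_of_position {g : ℝ → V3 → ℝ}
    (hg : ContDiff ℝ (⊤ : ℕ∞) (fun x : ℝ × V3 => g x.1 x.2)) (i : Fin 3) (x : ℝ × Phase) :
    dirDeriv (momDir i) (fun x : ℝ × Phase => g x.1 x.2.1) x = 0 := by
  rw [← pp_eq_dirDeriv (F := fun t z => g t z.1)
    (hg.comp (contDiff_fst.prodMk (contDiff_fst.comp contDiff_snd))) i x.1 x.2]
  simp [pp]

theorem momDir_momentum {i j : Fin 3} : (momDir i).2.2 j = if j = i then 1 else 0 := by
  simp [momDir, Pi.single_apply]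

theorem Xact_hamiltonian {m e : ℝ} {φ : ℝ → V3 → ℝ}
    (hφ : ContDiff ℝ (⊤ : ℕ∞) (fun x : ℝ × V3 => φ x.1 x.2)) {h : ℝ → Phase → ℝ}
    (hh : ∀ t z, h t z = (∑ i : Fin 3, (z.2 i) ^ 2) / (2 * m) + e * φ t z.1)
    {G : ℝ → Phase → ℝ} (hG : ContDiff ℝ (⊤ : ℕ∞) (fun x : ℝ × Phase => G x.1 x.2))
    (t : ℝ) (z : Phase) :
    Xact (h t) (G t) z = vlasovField m e (fun x => φ x.1 x.2.1) (fun x => G x.1 x.2) (t, z) := by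
  have hΦ : ContDiff ℝ (⊤ : ℕ∞) (fun x : ℝ × Phase => φ x.1 x.2.1) :=
    hφ.comp (contDiff_fst.prodMk (contDiff_fst.comp contDiff_snd))
  have hK : ContDiff ℝ (⊤ : ℕ∞)
      (fun x : ℝ × Phase => ∑ k : Fin 3, (1 / (2 * m)) * (x.2.2 k * x.2.2 k)) := by fun_prop
  have hH : (fun x : ℝ × Phase => h x.1 x.2) = fun x : ℝ × Phase =>
      (∑ k : Fin 3, (1 / (2 * m)) * (x.2.2 k * x.2.2 k)) + e * φ x.1 x.2.1 := by
    funext x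
    rw [hh, ← Finset.mul_sum]
    simp only [pow_two]
    ring
  have hHs : ContDiff ℝ (⊤ : ℕ∞) (fun x : ℝ × Phase => h x.1 x.2) :=
    hH ▸ hK.add (contDiff_const.mul hΦ)
  have d {F : ℝ × Phase → ℝ} (hF : ContDiff ℝ (⊤ : ℕ∞) F) (x) : DifferentiableAt ℝ F x :=
    (hF.differentiable (by simp)) x
  have hv (v x : ℝ × Phase) : dirDeriv v (fun x : ℝ × Phase => h x.1 x.2) x =
      (1 / m) * (∑ k : Fin 3, v.2.2 k * x.2.2 k)
        + e * dirDeriv v (fun x : ℝ × Phase => φ x.1 x.2.1) x := by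
    have hk (k : Fin 3) := (contDiff_momentum k).mul (contDiff_momentum k)
    rw [hH, dirDeriv_add _ _ (d hK x) (d (contDiff_const.mul hΦ) x),
      dirDeriv_const_mul _ _ _ (d hΦ x),
      dirDeriv_sum _ _ _ (fun k _ => d (contDiff_const.mul (hk k)) x), Finset.mul_sum]
    congr 1
    refine Finset.sum_congr rfl fun k _ => ?_
    rw [dirDeriv_const_mul _ _ _ (d (hk k) x),
      dirDeriv_mul _ _ (d (contDiff_momentum k) x) (d (contDiff_momentum k) x), dirDeriv_momentum]
    ring
  refine Finset.sum_congr rfl fun i _ => ?_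
  rw [pp_eq_dirDeriv hHs, pq_eq_dirDeriv hHs, pp_eq_dirDeriv hG, pq_eq_dirDeriv hG, hv, hv,
    dirDeriv_momDir_of_position hφ]
  simp [momDir_momentum, posDir]
  ring

/-- the momentum-Vlasov equations imply the Vlasov equation for the
plasma density `f = Σᵢ (∂Πᵢ/∂pᵢ − ∂Πⁱ/∂qᵢ)`.  Here `Pq i` is the component `Π_i`
(the `dq`-components) and `Pp i` is the component `Πⁱ` (the `dp`-components). -/
theorem momentum_vlasov_implies_vlasov
    (m e : ℝ) (hm : 0 < m)
    (φ : ℝ → V3 → ℝ)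
    (hφ : ContDiff ℝ (⊤ : ℕ∞) (fun x : ℝ × V3 => φ x.1 x.2))
    (h : ℝ → Phase → ℝ)
    (hh : ∀ t z, h t z = (∑ i : Fin 3, (z.2 i) ^ 2) / (2 * m) + e * φ t z.1)
    (Pq Pp : Fin 3 → ℝ → Phase → ℝ)
    (hPq : ∀ i, ContDiff ℝ (⊤ : ℕ∞) (fun x : ℝ × Phase => Pq i x.1 x.2))
    (hPp : ∀ i, ContDiff ℝ (⊤ : ℕ∞) (fun x : ℝ × Phase => Pp i x.1 x.2))
    (heq1 : ∀ i t z, deriv (fun s => Pq i s z) t =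
      -Xact (h t) (Pq i t) z
        + e * ∑ j : Fin 3, dq3 i (fun q => dq3 j (φ t) q) z.1 * Pp j t z)
    (heq2 : ∀ i t z, deriv (fun s => Pp i s z) t =
      -Xact (h t) (Pp i t) z - (1 / m) * Pq i t z)
    (f : ℝ → Phase → ℝ)
    (hf : ∀ t z, f t z = ∑ i : Fin 3, (pp i (Pq i t) z - pq i (Pp i t) z)) :
    ∀ t z, deriv (fun s => f s z) t
        + ∑ i : Fin 3, (z.2 i / m) * pq i (f t) z
        - e * ∑ i : Fin 3, dq3 i (φ t) z.1 * pp i (f t) z = 0 := by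
  intro t z
  set Φ : ℝ × Phase → ℝ := fun x => φ x.1 x.2.1 with hΦdef
  set A : Fin 3 → ℝ × Phase → ℝ := fun i x => Pq i x.1 x.2 with hAdef
  set B : Fin 3 → ℝ × Phase → ℝ := fun i x => Pp i x.1 x.2 with hBdef
  have hΦ : ContDiff ℝ (⊤ : ℕ∞) Φ :=
    hφ.comp (contDiff_fst.prodMk (contDiff_fst.comp contDiff_snd))
  have hA (i) : ContDiff ℝ (⊤ : ℕ∞) (A i) := hPq i
  have hB (i) : ContDiff ℝ (⊤ : ℕ∞) (B i) := hPp i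
  have d {F : ℝ × Phase → ℝ} (hF : ContDiff ℝ (⊤ : ℕ∞) F) (x) : DifferentiableAt ℝ F x :=
    (hF.differentiable (by simp)) x
  have hφ₁ (j : Fin 3) : (fun x : ℝ × Phase => dq3 j (φ x.1) x.2.1) = dirDeriv (posDir j) Φ :=
    funext fun x => dq3_eq_dirDeriv hφ j x.1 x.2
  have hφ₂ (i j : Fin 3) (t : ℝ) (z : Phase) : dq3 i (fun q => dq3 j (φ t) q) z.1 =
      dirDeriv (posDir i) (dirDeriv (posDir j) Φ) (t, z) := by
    rw [← hφ₁]
    exact dq3_eq_dirDeriv (g := fun t q => dq3 j (φ t) q) (contDiff_dq3 hφ j) i t z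
  have hmom (i j : Fin 3) (x) : dirDeriv (momDir i) (dirDeriv (posDir j) Φ) x = 0 := by
    rw [← hφ₁]
    exact dirDeriv_momDir_of_position (g := fun t q => dq3 j (φ t) q) (contDiff_dq3 hφ j) i x
  have hmom₂ (i j k : Fin 3) (x) :
      dirDeriv (momDir i) (dirDeriv (posDir j) (dirDeriv (posDir k) Φ)) x = 0 := by
    rw [dirDeriv_comm (hΦ.dirDeriv _), funext (hmom i k)]
    simp [dirDeriv]
  have hAt (i) : dirDeriv timeDir (A i) = fun x => -vlasovField m e Φ (A i) x
      + e * ∑ j : Fin 3, dirDeriv (posDir i) (dirDeriv (posDir j) Φ) x * B j x := by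
    funext x
    have := heq1 i x.1 x.2
    rw [deriv_time_eq_dirDeriv (hPq i), Xact_hamiltonian hφ hh (hPq i)] at this
    simpa only [hφ₂] using this
  have hBt (i) : dirDeriv timeDir (B i) = fun x => -vlasovField m e Φ (B i) x
      - (1 / m) * A i x := by
    funext x
    have := heq2 i x.1 x.2
    rwa [deriv_time_eq_dirDeriv (hPp i), Xact_hamiltonian hφ hh (hPp i)] at this
  have hfF : (fun x : ℝ × Phase => f x.1 x.2) = fun x =>
      ∑ i : Fin 3, (dirDeriv (momDir i) (A i) x - dirDeriv (posDir i) (B i) x) := by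
    funext x
    rw [hf]
    exact Finset.sum_congr rfl fun i _ =>
      congrArg₂ _ (pp_eq_dirDeriv (hPq i) i x.1 x.2) (pq_eq_dirDeriv (hPp i) i x.1 x.2)
  have hfs : ContDiff ℝ (⊤ : ℕ∞) (fun x : ℝ × Phase => f x.1 x.2) :=
    hfF ▸ ContDiff.sum fun i _ => ((hA i).dirDeriv _).sub ((hB i).dirDeriv _)
  have hdf (v x) : dirDeriv v (fun x : ℝ × Phase => f x.1 x.2) x =
      ∑ i : Fin 3, (dirDeriv v (dirDeriv (momDir i) (A i)) x
        - dirDeriv v (dirDeriv (posDir i) (B i)) x) := by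
    rw [hfF, dirDeriv_sum _ _ _ fun i _ => d (((hA i).dirDeriv _).sub ((hB i).dirDeriv _)) x]
    exact Finset.sum_congr rfl fun i _ =>
      dirDeriv_sub _ _ (d ((hA i).dirDeriv _) x) (d ((hB i).dirDeriv _) x)
  have hAc (i) (x) : dirDeriv timeDir (dirDeriv (momDir i) (A i)) x =
      -vlasovField m e Φ (dirDeriv (momDir i) (A i)) x - (1 / m) * dirDeriv (posDir i) (A i) x
      + e * ∑ j : Fin 3, dirDeriv (posDir i) (dirDeriv (posDir j) Φ) x
        * dirDeriv (momDir i) (B j) x := by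
    have hs (j : Fin 3) := ((hΦ.dirDeriv (posDir j)).dirDeriv (posDir i)).mul (hB j)
    have hS := ContDiff.sum (s := Finset.univ) fun (j : Fin 3) _ => hs j
    rw [dirDeriv_comm (hA i), hAt, dirDeriv_add _ _ (d (hΦ.vlasovField (hA i)).neg x)
      (d (contDiff_const.mul hS) x), dirDeriv_neg, dirDeriv_vlasovField hΦ (hA i),
      dirDeriv_const_mul _ _ _ (d hS x), dirDeriv_sum _ _ _ fun j _ => d (hs j) x]
    simp only [dirDeriv_mul _ _ (d ((hΦ.dirDeriv _).dirDeriv _) x) (d (hB _) x), hmom, hmom₂,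
      momDir_momentum]
    simp
    ring
  have hBc (i) (x) : dirDeriv timeDir (dirDeriv (posDir i) (B i)) x =
      -vlasovField m e Φ (dirDeriv (posDir i) (B i)) x - (1 / m) * dirDeriv (posDir i) (A i) x
      + e * ∑ j : Fin 3, dirDeriv (posDir i) (dirDeriv (posDir j) Φ) x
        * dirDeriv (momDir j) (B i) x := by
    rw [dirDeriv_comm (hB i), hBt, dirDeriv_sub _ _ (d (hΦ.vlasovField (hB i)).neg x)
      (d (contDiff_const.mul (hA i)) x), dirDeriv_neg, dirDeriv_vlasovField hΦ (hB i),
      dirDeriv_const_mul _ _ _ (d (hA i) x), Finset.mul_sum]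
    simp [posDir]
    ring
  have hsymm : ∑ i : Fin 3, ∑ j : Fin 3, dirDeriv (posDir i) (dirDeriv (posDir j) Φ) (t, z)
        * dirDeriv (momDir i) (B j) (t, z) =
      ∑ i : Fin 3, ∑ j : Fin 3, dirDeriv (posDir i) (dirDeriv (posDir j) Φ) (t, z)
        * dirDeriv (momDir j) (B i) (t, z) := by
    rw [Finset.sum_comm]
    exact Finset.sum_congr rfl fun i _ => Finset.sum_congr rfl fun j _ => by
      rw [dirDeriv_comm hΦ]
  rw [deriv_time_eq_dirDeriv hfs, hdf]
  simp only [pq_eq_dirDeriv hfs, pp_eq_dirDeriv hfs, hdf, dq3_eq_dirDeriv hφ, hAc, hBc]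
  simp only [vlasovField, Fin.sum_univ_three] at hsymm ⊢
  linear_combination e * hsymm
end
end

section
/- Let m > 0 and e be real constants, let φ : ℝ × ℝ³ → ℝ and Ψ : ℝ × ℝ³ → ℝ be smooth, and set h(t, q, p) = |p|²/(2m) + e·φ(t, q). Suppose smooth functions Π_i, Πⁱ (i = 1,2,3) on ℝ × (ℝ³ × ℝ³) satisfy the gradient-shifted momentum-Vlasov equations ∂Π_i/∂t = −X_h(Π_i) + e·Σ_j (∂²φ/∂q_i∂q_j)·Πʲ + ∂Ψ/∂q_i and ∂Πⁱ/∂t = −X_h(Πⁱ) − (1/m)·Π_i. Then the plasma density f(t, z) = Σ_i (∂Π_i/∂p_i − ∂Πⁱ/∂q_i) still satisfies the Vlasov equation ∂f/∂t + Σ_i (p_i/m)·∂f/∂q_i − e·Σ_i (∂φ/∂q_i)·∂f/∂p_i = 0; i.e., adding to the dq-components of the momentum equations the gradient of an arbitrary function of (t, q) does not change the induced evolution of the density. -/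
open MeasureTheory

noncomputable section

/-- Space-time: a time together with a point of phase space. -/
abbrev STime : Type := ℝ × Phase

/-- The unit vector in the time direction. -/
def vT : STime := (1, 0)

/-- The unit vector in the `i`-th position direction. -/
def vQ (i : Fin 3) : STime := (0, (Pi.single i 1, 0))

/-- The unit vector in the `i`-th momentum direction. -/
def vP (i : Fin 3) : STime := (0, (0, Pi.single i 1))

/-- Directional derivative on space-time. -/
def dirD (v : STime) (F : STime → ℝ) (x : STime) : ℝ := fderiv ℝ F x v

/-- Smoothness on space-time. -/
abbrev Smooth (F : STime → ℝ) : Prop := ContDiff ℝ (⊤ : ℕ∞) F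

lemma Smooth.differentiableAt {F : STime → ℝ} (hF : Smooth F) (x : STime) :
    DifferentiableAt ℝ F x :=
  (hF.differentiable (by simp)) x

lemma Smooth.dirD {F : STime → ℝ} (hF : Smooth F) (v : STime) : Smooth (dirD v F) :=
  (hF.fderiv_right (m := (⊤ : ℕ∞)) (by simp)).clm_apply contDiff_const

lemma dirD_comm {F : STime → ℝ} (hF : Smooth F) (v w : STime) (x : STime) :
    dirD v (dirD w F) x = dirD w (dirD v F) x := by
  have hd : DifferentiableAt ℝ (fderiv ℝ F) x :=
    ((hF.fderiv_right (m := (⊤ : ℕ∞)) (by simp)).differentiable (by simp)) x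
  have key : ∀ a b : STime, dirD a (dirD b F) x = fderiv ℝ (fderiv ℝ F) x a b := by
    intro a b
    have := (hd.hasFDerivAt.clm_apply (hasFDerivAt_const b x)).fderiv
    simp only [dirD] at *
    change fderiv ℝ (fun y => fderiv ℝ F y b) x a = _
    rw [this]
    simp
  rw [key, key]
  exact (hF.contDiffAt.isSymmSndFDerivAt
    (by simpa using WithTop.coe_le_coe.2 (le_top : (2 : ℕ∞) ≤ ⊤))).eq v w

lemma dirD_add {F G : STime → ℝ} (hF : Smooth F) (hG : Smooth G) (v x : STime) :
    dirD v (fun y => F y + G y) x = dirD v F x + dirD v G x := by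
  simp [dirD, fderiv_fun_add (hF.differentiableAt x) (hG.differentiableAt x)]

lemma dirD_sub {F G : STime → ℝ} (hF : Smooth F) (hG : Smooth G) (v x : STime) :
    dirD v (fun y => F y - G y) x = dirD v F x - dirD v G x := by
  simp [dirD, fderiv_fun_sub (hF.differentiableAt x) (hG.differentiableAt x)]

lemma dirD_neg (F : STime → ℝ) (v x : STime) :
    dirD v (fun y => -F y) x = -dirD v F x := by
  simp [dirD, fderiv_fun_neg]

lemma dirD_mul {F G : STime → ℝ} (hF : Smooth F) (hG : Smooth G) (v x : STime) :
    dirD v (fun y => F y * G y) x = F x * dirD v G x + dirD v F x * G x := by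
  simp [dirD, fderiv_fun_mul (hF.differentiableAt x) (hG.differentiableAt x), mul_comm]

lemma dirD_const_mul {F : STime → ℝ} (hF : Smooth F) (c : ℝ) (v x : STime) :
    dirD v (fun y => c * F y) x = c * dirD v F x := by
  simp [dirD, fderiv_const_mul (hF.differentiableAt x)]

lemma dirD_sum {F : Fin 3 → STime → ℝ} (hF : ∀ i, Smooth (F i)) (v x : STime) :
    dirD v (fun y => ∑ i, F i y) x = ∑ i, dirD v (F i) x := by
  simp [dirD, fderiv_fun_sum fun i _ => (hF i).differentiableAt x]

lemma deriv_time {F : STime → ℝ} (hF : Smooth F) (t : ℝ) (z : Phase) :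
    deriv (fun s => F (s, z)) t = dirD vT F (t, z) :=
  ((hF.differentiableAt (t, z)).hasFDerivAt.comp_hasDerivAt t
    ((hasDerivAt_id t).prodMk (hasDerivAt_const t z))).deriv

lemma pq_eq_dirD {F : STime → ℝ} (hF : Smooth F) (i : Fin 3) (t : ℝ) (z : Phase) :
    pq i (fun w => F (t, w)) z = dirD (vQ i) F (t, z) := by
  have h := (hasDerivAt_const (z.1 i) t).prodMk
    ((hasDerivAt_update z.1 i (z.1 i)).prodMk (hasDerivAt_const (z.1 i) z.2))
  exact (HasFDerivAt.comp_hasDerivAt_of_eq _ (hF.differentiableAt (t, z)).hasFDerivAt h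
    (by simp)).deriv

lemma pp_eq_dirD {F : STime → ℝ} (hF : Smooth F) (i : Fin 3) (t : ℝ) (z : Phase) :
    pp i (fun w => F (t, w)) z = dirD (vP i) F (t, z) := by
  have h := (hasDerivAt_const (z.2 i) t).prodMk
    ((hasDerivAt_const (z.2 i) z.1).prodMk (hasDerivAt_update z.2 i (z.2 i)))
  exact (HasFDerivAt.comp_hasDerivAt_of_eq _ (hF.differentiableAt (t, z)).hasFDerivAt h
    (by simp)).deriv

/-- A function of time and position, seen as a function on space-time. -/
def liftQ (g : ℝ → V3 → ℝ) (x : STime) : ℝ := g x.1 x.2.1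

lemma smooth_liftQ {g : ℝ → V3 → ℝ}
    (hg : ContDiff ℝ (⊤ : ℕ∞) (fun x : ℝ × V3 => g x.1 x.2)) : Smooth (liftQ g) :=
  hg.comp (contDiff_fst.prodMk contDiff_snd.fst)

lemma dq3_eq_dirD {g : ℝ → V3 → ℝ} (hg : Smooth (liftQ g)) (i : Fin 3) (t : ℝ) (z : Phase) :
    dq3 i (g t) z.1 = dirD (vQ i) (liftQ g) (t, z) :=
  pq_eq_dirD hg i t z

lemma liftQ_dq3 {g : ℝ → V3 → ℝ} (hg : Smooth (liftQ g)) (i : Fin 3) :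
    liftQ (fun t q => dq3 i (g t) q) = dirD (vQ i) (liftQ g) :=
  funext fun x => dq3_eq_dirD hg i x.1 x.2

lemma dirD_vP_liftQ {g : ℝ → V3 → ℝ} (hg : Smooth (liftQ g)) (i : Fin 3) (x : STime) :
    dirD (vP i) (liftQ g) x = 0 := by
  rw [← pp_eq_dirD hg i x.1 x.2]
  simp [pp, liftQ]

/-- The `k`-th momentum coordinate. -/
def momentum (k : Fin 3) (x : STime) : ℝ := x.2.2 k

lemma smooth_momentum (k : Fin 3) : Smooth (momentum k) := by
  change ContDiff ℝ _ fun x : STime => x.2.2 k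
  fun_prop

lemma dirD_momentum (k : Fin 3) (v x : STime) : dirD v (momentum k) x = v.2.2 k := by
  let L : STime →L[ℝ] ℝ := (ContinuousLinearMap.proj (R := ℝ) (φ := fun _ : Fin 3 => ℝ) k).comp
    ((ContinuousLinearMap.snd ℝ V3 V3).comp (ContinuousLinearMap.snd ℝ ℝ Phase))
  have h : HasFDerivAt (momentum k) L x := L.hasFDerivAt
  simp [dirD, h.fderiv, L]

/-- The Hamiltonian vector field of `|p|² / (2m) + e φ`, acting on space-time functions. -/
def flow (m e : ℝ) (Φ G : STime → ℝ) (x : STime) : ℝ :=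
  ∑ k : Fin 3, (1 / m * (momentum k x * dirD (vQ k) G x)
    - e * (dirD (vQ k) Φ x * dirD (vP k) G x))

lemma Smooth.flow {Φ G : STime → ℝ} (hΦ : Smooth Φ) (hG : Smooth G) (m e : ℝ) :
    Smooth (flow m e Φ G) :=
  ContDiff.sum fun k _ =>
    (contDiff_const.mul ((smooth_momentum k).mul (hG.dirD _))).sub
      (contDiff_const.mul ((hΦ.dirD _).mul (hG.dirD _)))

lemma dirD_flow {Φ G : STime → ℝ} (hΦ : Smooth Φ) (hG : Smooth G) (m e : ℝ) (v x : STime) :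
    dirD v (flow m e Φ G) x = flow m e Φ (dirD v G) x
      + ∑ k : Fin 3, (1 / m * (v.2.2 k * dirD (vQ k) G x)
        - e * (dirD v (dirD (vQ k) Φ) x * dirD (vP k) G x)) := by
  have h1 : ∀ k, Smooth (fun y => momentum k y * dirD (vQ k) G y) := fun k =>
    (smooth_momentum k).mul (hG.dirD _)
  have h2 : ∀ k, Smooth (fun y => dirD (vQ k) Φ y * dirD (vP k) G y) := fun k =>
    (hΦ.dirD _).mul (hG.dirD _)
  have h3 : ∀ k, Smooth (fun y => 1 / m * (momentum k y * dirD (vQ k) G y)) := fun k =>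
    contDiff_const.mul (h1 k)
  have h4 : ∀ k, Smooth (fun y => e * (dirD (vQ k) Φ y * dirD (vP k) G y)) := fun k =>
    contDiff_const.mul (h2 k)
  unfold flow
  rw [dirD_sum fun k => (h3 k).sub (h4 k), ← Finset.sum_add_distrib]
  refine Finset.sum_congr rfl fun k _ => ?_
  rw [dirD_sub (h3 k) (h4 k), dirD_const_mul (h1 k), dirD_const_mul (h2 k),
    dirD_mul (smooth_momentum k) (hG.dirD _), dirD_mul (hΦ.dirD _) (hG.dirD _),
    dirD_momentum, dirD_comm hG v, dirD_comm hG v]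
  ring

lemma flow_sub {F G : STime → ℝ} (hF : Smooth F) (hG : Smooth G) (m e : ℝ)
    (Φ : STime → ℝ) (x : STime) :
    flow m e Φ (fun y => F y - G y) x = flow m e Φ F x - flow m e Φ G x := by
  simp only [flow, dirD_sub hF hG, ← Finset.sum_sub_distrib]
  exact Finset.sum_congr rfl fun k _ => by ring

lemma flow_sum {F : Fin 3 → STime → ℝ} (hF : ∀ i, Smooth (F i)) (m e : ℝ)
    (Φ : STime → ℝ) (x : STime) :
    flow m e Φ (fun y => ∑ i, F i y) x = ∑ i, flow m e Φ (F i) x := by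
  simp only [flow, dirD_sum hF]
  rw [Finset.sum_comm]
  simp only [Finset.mul_sum, Finset.sum_sub_distrib]

/-- The density of a solution of the shifted momentum-Vlasov system, in terms of directional
derivatives on space-time, is transported by the Hamiltonian flow. -/
lemma dirD_density {m e : ℝ} {φ Ψ : ℝ → V3 → ℝ} (hφ : Smooth (liftQ φ)) (hΨ : Smooth (liftQ Ψ))
    {A B : Fin 3 → STime → ℝ} (hA : ∀ i, Smooth (A i)) (hB : ∀ i, Smooth (B i))
    (hAt : ∀ i, dirD vT (A i) = fun x => -flow m e (liftQ φ) (A i) x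
      + e * ∑ j, dirD (vQ i) (dirD (vQ j) (liftQ φ)) x * B j x + dirD (vQ i) (liftQ Ψ) x)
    (hBt : ∀ i, dirD vT (B i) = fun x => -flow m e (liftQ φ) (B i) x - 1 / m * A i x)
    (x : STime) :
    dirD vT (fun y => ∑ i, (dirD (vP i) (A i) y - dirD (vQ i) (B i) y)) x
      = -flow m e (liftQ φ) (fun y => ∑ i, (dirD (vP i) (A i) y - dirD (vQ i) (B i) y)) x := by
  have hAP : ∀ i, Smooth (dirD (vP i) (A i)) := fun i => (hA i).dirD _
  have hBQ : ∀ i, Smooth (dirD (vQ i) (B i)) := fun i => (hB i).dirD _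
  have hPφ : ∀ i j (y : STime), dirD (vP i) (dirD (vQ j) (liftQ φ)) y = 0 := fun i j y => by
    rw [dirD_comm hφ, show dirD (vP i) (liftQ φ) = fun _ => 0 from
      funext (dirD_vP_liftQ hφ i)]
    simp [dirD]
  have hPφφ : ∀ i j k (y : STime),
      dirD (vP i) (dirD (vQ j) (dirD (vQ k) (liftQ φ))) y = 0 := fun i j k y => by
    rw [dirD_comm (hφ.dirD _), show dirD (vP i) (dirD (vQ k) (liftQ φ)) = fun _ => 0 from
      funext (hPφ i k)]
    simp [dirD]
  have hPΨ : ∀ i j (y : STime), dirD (vP i) (dirD (vQ j) (liftQ Ψ)) y = 0 := fun i j y => by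
    rw [dirD_comm hΨ, show dirD (vP i) (liftQ Ψ) = fun _ => 0 from
      funext (dirD_vP_liftQ hΨ i)]
    simp [dirD]
  have hS : ∀ i j, Smooth (fun y => dirD (vQ i) (dirD (vQ j) (liftQ φ)) y * B j y) :=
    fun i j => ((hφ.dirD _).dirD _).mul (hB j)
  have hSum : ∀ i, Smooth (fun y => ∑ j, dirD (vQ i) (dirD (vQ j) (liftQ φ)) y * B j y) :=
    fun i => ContDiff.sum fun j _ => hS i j
  have hA' : ∀ i, dirD vT (dirD (vP i) (A i)) x = -flow m e (liftQ φ) (dirD (vP i) (A i)) x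
      - 1 / m * dirD (vQ i) (A i) x
      + e * ∑ j, dirD (vQ i) (dirD (vQ j) (liftQ φ)) x * dirD (vP i) (B j) x := by
    intro i
    have hf := hφ.flow (hA i) m e
    rw [dirD_comm (hA i), hAt, dirD_add (hf.neg.add (contDiff_const.mul (hSum i))) (hΨ.dirD _),
      dirD_add hf.neg (contDiff_const.mul (hSum i)), dirD_neg, dirD_const_mul (hSum i),
      dirD_sum (hS i), dirD_flow hφ (hA i)]
    simp only [dirD_mul ((hφ.dirD _).dirD _) (hB _), hPφ, hPφφ, hPΨ]
    simp [vP, Pi.single_apply]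
    ring
  have hB' : ∀ i, dirD vT (dirD (vQ i) (B i)) x = -flow m e (liftQ φ) (dirD (vQ i) (B i)) x
      - 1 / m * dirD (vQ i) (A i) x
      + e * ∑ k, dirD (vQ i) (dirD (vQ k) (liftQ φ)) x * dirD (vP k) (B i) x := by
    intro i
    have hf := hφ.flow (hB i) m e
    rw [dirD_comm (hB i), hBt, dirD_sub hf.neg (contDiff_const.mul (hA i)), dirD_neg,
      dirD_const_mul (hA i), dirD_flow hφ (hB i)]
    simp [vQ, Finset.mul_sum]
    ring
  have hsymm : ∑ i, ∑ j, dirD (vQ i) (dirD (vQ j) (liftQ φ)) x * dirD (vP i) (B j) x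
      = ∑ i, ∑ k, dirD (vQ i) (dirD (vQ k) (liftQ φ)) x * dirD (vP k) (B i) x := by
    rw [Finset.sum_comm]
    exact Finset.sum_congr rfl fun j _ => Finset.sum_congr rfl fun i _ => by
      rw [dirD_comm hφ]
  rw [dirD_sum fun i => (hAP i).sub (hBQ i), flow_sum fun i => (hAP i).sub (hBQ i)]
  simp only [dirD_sub (hAP _) (hBQ _), flow_sub (hAP _) (hBQ _), hA', hB',
    Finset.sum_sub_distrib, Finset.sum_add_distrib, ← Finset.mul_sum, hsymm,
    Finset.sum_neg_distrib]
  ring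

lemma Xact_eq_flow {m e : ℝ} (hm : m ≠ 0) {φ : ℝ → V3 → ℝ} (hφ : Smooth (liftQ φ))
    {h : ℝ → Phase → ℝ}
    (hh : ∀ t z, h t z = (∑ i : Fin 3, (z.2 i) ^ 2) / (2 * m) + e * φ t z.1)
    {G : STime → ℝ} (hG : Smooth G) (t : ℝ) (z : Phase) :
    Xact (h t) (fun w => G (t, w)) z = flow m e (liftQ φ) G (t, z) := by
  refine Finset.sum_congr rfl fun k _ => ?_
  have hq : pq k (h t) z = e * dirD (vQ k) (liftQ φ) (t, z) := by
    rw [← dq3_eq_dirD hφ]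
    simp [pq, dq3, hh, deriv_const_mul_field]
  have hp : pp k (h t) z = z.2 k / m := by
    have hd : HasDerivAt (fun s => (∑ i : Fin 3, (Function.update z.2 k s i) ^ 2) / (2 * m)
        + e * φ t z.1) ((∑ i : Fin 3, 2 * z.2 i * (Pi.single k 1 : V3) i) / (2 * m)) (z.2 k) := by
      refine ((HasDerivAt.fun_sum fun i _ => ?_).div_const _).add_const _
      simpa using ((hasDerivAt_pi.1 (hasDerivAt_update z.2 k (z.2 k))) i).fun_pow 2
    simp only [pp, hh]
    rw [hd.deriv]
    simp [Pi.single_apply]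
    field_simp
  rw [hq, hp, pq_eq_dirD hG, pp_eq_dirD hG]
  simp only [momentum]
  ring

/-- the gradient-shifted momentum-Vlasov equations (the `dq`-component
equations are shifted by `∂Ψ/∂qᵢ` for an arbitrary smooth `Ψ(t,q)`) still imply the
Vlasov equation for the plasma density `f = Σᵢ (∂Πᵢ/∂pᵢ − ∂Πⁱ/∂qᵢ)`. -/
theorem gradient_shifted_momentum_vlasov_implies_vlasov
    (m e : ℝ) (hm : 0 < m)
    (φ Ψ : ℝ → V3 → ℝ)
    (hφ : ContDiff ℝ (⊤ : ℕ∞) (fun x : ℝ × V3 => φ x.1 x.2))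
    (hΨ : ContDiff ℝ (⊤ : ℕ∞) (fun x : ℝ × V3 => Ψ x.1 x.2))
    (h : ℝ → Phase → ℝ)
    (hh : ∀ t z, h t z = (∑ i : Fin 3, (z.2 i) ^ 2) / (2 * m) + e * φ t z.1)
    (Pq Pp : Fin 3 → ℝ → Phase → ℝ)
    (hPq : ∀ i, ContDiff ℝ (⊤ : ℕ∞) (fun x : ℝ × Phase => Pq i x.1 x.2))
    (hPp : ∀ i, ContDiff ℝ (⊤ : ℕ∞) (fun x : ℝ × Phase => Pp i x.1 x.2))
    (heq1 : ∀ i t z, deriv (fun s => Pq i s z) t =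
      -Xact (h t) (Pq i t) z
        + e * ∑ j : Fin 3, dq3 i (fun q => dq3 j (φ t) q) z.1 * Pp j t z
        + dq3 i (Ψ t) z.1)
    (heq2 : ∀ i t z, deriv (fun s => Pp i s z) t =
      -Xact (h t) (Pp i t) z - (1 / m) * Pq i t z)
    (f : ℝ → Phase → ℝ)
    (hf : ∀ t z, f t z = ∑ i : Fin 3, (pp i (Pq i t) z - pq i (Pp i t) z)) :
    ∀ t z, deriv (fun s => f s z) t
        + ∑ i : Fin 3, (z.2 i / m) * pq i (f t) z
        - e * ∑ i : Fin 3, dq3 i (φ t) z.1 * pp i (f t) z = 0 := by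
  have sφ := smooth_liftQ hφ
  have sΨ := smooth_liftQ hΨ
  have hm' := hm.ne'
  let A : Fin 3 → STime → ℝ := fun i x => Pq i x.1 x.2
  let B : Fin 3 → STime → ℝ := fun i x => Pp i x.1 x.2
  have hA : ∀ i, Smooth (A i) := hPq
  have hB : ∀ i, Smooth (B i) := hPp
  have hAt : ∀ i, dirD vT (A i) = fun x => -flow m e (liftQ φ) (A i) x
      + e * ∑ j, dirD (vQ i) (dirD (vQ j) (liftQ φ)) x * B j x
      + dirD (vQ i) (liftQ Ψ) x := by
    intro i
    funext x
    have hdd : ∀ j, dq3 i (fun q => dq3 j (φ x.1) q) x.2.1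
        = dirD (vQ i) (dirD (vQ j) (liftQ φ)) x := fun j => by
      have hs := sφ.dirD (vQ j)
      rw [← liftQ_dq3 sφ] at hs ⊢
      exact dq3_eq_dirD hs i x.1 x.2
    have := heq1 i x.1 x.2
    simp only [hdd, dq3_eq_dirD sΨ] at this
    rw [← Xact_eq_flow hm' sφ hh (hA i) x.1 x.2]
    exact (deriv_time (hA i) x.1 x.2).symm.trans this
  have hBt : ∀ i, dirD vT (B i) = fun x => -flow m e (liftQ φ) (B i) x - 1 / m * A i x := by
    intro i
    funext x
    rw [← Xact_eq_flow hm' sφ hh (hB i) x.1 x.2]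
    exact (deriv_time (hB i) x.1 x.2).symm.trans (heq2 i x.1 x.2)
  let F : STime → ℝ := fun y => ∑ i, (dirD (vP i) (A i) y - dirD (vQ i) (B i) y)
  have hF : Smooth F := ContDiff.sum fun i _ => ((hA i).dirD _).sub ((hB i).dirD _)
  have hfF : f = fun t z => F (t, z) := by
    funext t z
    rw [hf]
    exact Finset.sum_congr rfl fun i _ =>
      congrArg₂ _ (pp_eq_dirD (hA i) i t z) (pq_eq_dirD (hB i) i t z)
  intro t z
  subst hfF
  simp only [deriv_time hF, pq_eq_dirD hF, pp_eq_dirD hF, dq3_eq_dirD sφ]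
  have hT : dirD vT F (t, z) = -flow m e (liftQ φ) F (t, z) :=
    dirD_density sφ sΨ hA hB hAt hBt (t, z)
  rw [hT]
  simp only [flow, momentum, Finset.sum_sub_distrib, ← Finset.mul_sum, div_eq_inv_mul, mul_assoc]
  ring
end
end

section
/- Let a, b be smooth functions on ℝ³ × ℝ³ and let Π be a momentum one-form whose six component functions are smooth and compactly supported. Let [X_a, X_b] denote the Jacobi–Lie bracket (commutator) of the Hamiltonian vector fields of a and b, i.e., the vector field whose action on smooth functions g is [X_a, X_b](g) = X_a(X_b(g)) − X_b(X_a(g)). Then ∫ ⟨Π, [X_a, X_b]⟩ dμ = ∫ f·{a, b} dμ, where f = Σ_i (∂Π_i/∂p_i − ∂Πⁱ/∂q_i); i.e., the Lie–Poisson bracket integrand in momentum variables passes to the canonical Poisson bracket weighted by the density. -/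
open MeasureTheory

noncomputable section

/-- The `i`-th coordinate function `q i` on phase space. -/
def coordq (i : Fin 3) : Phase → ℝ := fun z => z.1 i

/-- The `i`-th coordinate function `p i` on phase space. -/
def coordp (i : Fin 3) : Phase → ℝ := fun z => z.2 i

/-- The `qᵢ`-component of the Jacobi–Lie bracket `[X_a, X_b]`, namely its action
`X_a(X_b(qᵢ)) − X_b(X_a(qᵢ))` on the coordinate function `qᵢ`. -/
def bracketQ (a b : Phase → ℝ) (i : Fin 3) (z : Phase) : ℝ :=
  Xact a (Xact b (coordq i)) z - Xact b (Xact a (coordq i)) z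

/-- The `pᵢ`-component of the Jacobi–Lie bracket `[X_a, X_b]`. -/
def bracketP (a b : Phase → ℝ) (i : Fin 3) (z : Phase) : ℝ :=
  Xact a (Xact b (coordp i)) z - Xact b (Xact a (coordp i)) z

/-- The coordinate direction of `q i` in phase space. -/
def dirq (i : Fin 3) : Phase := (Pi.single i 1, 0)

/-- The coordinate direction of `p i` in phase space. -/
def dirp (i : Fin 3) : Phase := (0, Pi.single i 1)

theorem pq_eq_fderiv {F : Phase → ℝ} (hF : Differentiable ℝ F) (i : Fin 3) :
    pq i F = fun z => fderiv ℝ F z (dirq i) := by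
  funext z
  have h : HasDerivAt (fun s => (Function.update z.1 i s, z.2)) (dirq i) (z.1 i) :=
    (hasDerivAt_update z.1 i (z.1 i)).prodMk (hasDerivAt_const _ _)
  have hz : HasFDerivAt F (fderiv ℝ F z) (Function.update z.1 i (z.1 i), z.2) := by
    simpa using (hF z).hasFDerivAt
  exact (hz.comp_hasDerivAt _ h).deriv

theorem pp_eq_fderiv {F : Phase → ℝ} (hF : Differentiable ℝ F) (i : Fin 3) :
    pp i F = fun z => fderiv ℝ F z (dirp i) := by
  funext z
  have h : HasDerivAt (fun s => (z.1, Function.update z.2 i s)) (dirp i) (z.2 i) :=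
    (hasDerivAt_const _ _).prodMk (hasDerivAt_update z.2 i (z.2 i))
  have hz : HasFDerivAt F (fderiv ℝ F z) (z.1, Function.update z.2 i (z.2 i)) := by
    simpa using (hF z).hasFDerivAt
  exact (hz.comp_hasDerivAt _ h).deriv

theorem contDiff_fderiv_apply_const {F : Phase → ℝ} (hF : ContDiff ℝ (⊤ : ℕ∞) F) (v : Phase) :
    ContDiff ℝ (⊤ : ℕ∞) fun z => fderiv ℝ F z v :=
  (hF.fderiv_right (m := (⊤ : ℕ∞)) (by simp)).clm_apply contDiff_const

theorem differentiable_of_smooth {F : Phase → ℝ} (hF : ContDiff ℝ (⊤ : ℕ∞) F) :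
    Differentiable ℝ F :=
  hF.differentiable (by simp)

theorem fderiv_fderiv_apply_comm {F : Phase → ℝ} (hF : ContDiff ℝ (⊤ : ℕ∞) F) (v w z : Phase) :
    fderiv ℝ (fun y => fderiv ℝ F y v) z w = fderiv ℝ (fun y => fderiv ℝ F y w) z v := by
  have hd : DifferentiableAt ℝ (fderiv ℝ F) z :=
    (hF.fderiv_right (m := (⊤ : ℕ∞)) (by simp)).differentiable (by simp) z
  have hs : IsSymmSndFDerivAt ℝ F z :=
    hF.contDiffAt.isSymmSndFDerivAt (by
      rw [minSmoothness_of_isRCLikeNormedField]; exact WithTop.coe_le_coe.2 le_top)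
  rw [fderiv_clm_apply hd (by fun_prop), fderiv_clm_apply hd (by fun_prop)]
  simpa using hs w v

theorem integral_mul_fderiv_apply {P h : Phase → ℝ} (hP : ContDiff ℝ (⊤ : ℕ∞) P)
    (hc : HasCompactSupport P) (hh : ContDiff ℝ (⊤ : ℕ∞) h) (v : Phase) :
    Integrable (fun z => P z * fderiv ℝ h z v) ∧ Integrable (fun z => fderiv ℝ P z v * h z) ∧
    ∫ z, P z * fderiv ℝ h z v = - ∫ z, fderiv ℝ P z v * h z := by
  have h1 : Integrable (fun z => P z * fderiv ℝ h z v) :=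
    (hP.continuous.mul (contDiff_fderiv_apply_const hh v).continuous).integrable_of_hasCompactSupport
      hc.mul_right
  have h2 : Integrable (fun z => fderiv ℝ P z v * h z) :=
    ((contDiff_fderiv_apply_const hP v).continuous.mul hh.continuous).integrable_of_hasCompactSupport
      (hc.fderiv_apply (𝕜 := ℝ) v).mul_right
  have h3 : Integrable (fun z => P z * h z) :=
    (hP.continuous.mul hh.continuous).integrable_of_hasCompactSupport hc.mul_right
  have : (volume : Measure Phase).IsAddHaarMeasure := Measure.prod.instIsAddHaarMeasure _ _
  exact ⟨h1, h2, integral_mul_fderiv_eq_neg_fderiv_mul_of_integrable h2 h1 h3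
    (fun z _ => differentiable_of_smooth hP z) (fun z _ => differentiable_of_smooth hh z)⟩

theorem Xact_eq_fderiv {a F : Phase → ℝ} (ha : Differentiable ℝ a) (hF : Differentiable ℝ F) :
    Xact a F = fun z => ∑ i : Fin 3, (fderiv ℝ a z (dirp i) * fderiv ℝ F z (dirq i)
      - fderiv ℝ a z (dirq i) * fderiv ℝ F z (dirp i)) := by
  funext z
  simp only [Xact, pq_eq_fderiv ha, pp_eq_fderiv ha, pq_eq_fderiv hF, pp_eq_fderiv hF]

theorem fderiv_coordq (i : Fin 3) (z v : Phase) : fderiv ℝ (coordq i) z v = v.1 i := by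
  have h : HasFDerivAt (coordq i)
      ((ContinuousLinearMap.proj i).comp (ContinuousLinearMap.fst ℝ V3 V3)) z :=
    ((ContinuousLinearMap.proj i).comp (ContinuousLinearMap.fst ℝ V3 V3)).hasFDerivAt
  rw [h.fderiv]; rfl

theorem fderiv_coordp (i : Fin 3) (z v : Phase) : fderiv ℝ (coordp i) z v = v.2 i := by
  have h : HasFDerivAt (coordp i)
      ((ContinuousLinearMap.proj i).comp (ContinuousLinearMap.snd ℝ V3 V3)) z :=
    ((ContinuousLinearMap.proj i).comp (ContinuousLinearMap.snd ℝ V3 V3)).hasFDerivAt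
  rw [h.fderiv]; rfl

theorem Xact_coordq {a : Phase → ℝ} (ha : Differentiable ℝ a) (i : Fin 3) :
    Xact a (coordq i) = fun z => fderiv ℝ a z (dirp i) := by
  rw [Xact_eq_fderiv ha (by unfold coordq; fun_prop)]
  funext z
  simp [fderiv_coordq, dirq, dirp, Pi.single_apply]

theorem Xact_coordp {a : Phase → ℝ} (ha : Differentiable ℝ a) (i : Fin 3) :
    Xact a (coordp i) = fun z => -fderiv ℝ a z (dirq i) := by
  rw [Xact_eq_fderiv ha (by unfold coordp; fun_prop)]
  funext z
  simp [fderiv_coordp, dirq, dirp, Pi.single_apply]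

/-- The canonical Poisson bracket `{a, b}`. -/
def poisson (a b : Phase → ℝ) (z : Phase) : ℝ :=
  ∑ i : Fin 3, (fderiv ℝ a z (dirq i) * fderiv ℝ b z (dirp i)
    - fderiv ℝ a z (dirp i) * fderiv ℝ b z (dirq i))

theorem contDiff_poisson {a b : Phase → ℝ} (ha : ContDiff ℝ (⊤ : ℕ∞) a)
    (hb : ContDiff ℝ (⊤ : ℕ∞) b) : ContDiff ℝ (⊤ : ℕ∞) (poisson a b) :=
  ContDiff.sum fun i _ =>
    ((contDiff_fderiv_apply_const ha (dirq i)).mul (contDiff_fderiv_apply_const hb (dirp i))).sub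
      ((contDiff_fderiv_apply_const ha (dirp i)).mul (contDiff_fderiv_apply_const hb (dirq i)))

theorem fderiv_poisson_apply {a b : Phase → ℝ} (ha : ContDiff ℝ (⊤ : ℕ∞) a)
    (hb : ContDiff ℝ (⊤ : ℕ∞) b) (z v : Phase) :
    fderiv ℝ (poisson a b) z v =
      poisson (fun y => fderiv ℝ a y v) b z + poisson a (fun y => fderiv ℝ b y v) z := by
  have hd : ∀ {F : Phase → ℝ}, ContDiff ℝ (⊤ : ℕ∞) F → ∀ w : Phase,
      HasFDerivAt (fun y => fderiv ℝ F y w) (fderiv ℝ (fun y => fderiv ℝ F y w) z) z :=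
    fun hF w => (differentiable_of_smooth (contDiff_fderiv_apply_const hF w) z).hasFDerivAt
  have h : HasFDerivAt (poisson a b) _ z := HasFDerivAt.fun_sum fun i _ =>
    ((hd ha (dirq i)).mul (hd hb (dirp i))).sub ((hd ha (dirp i)).mul (hd hb (dirq i)))
  rw [h.fderiv, poisson, poisson, ← Finset.sum_add_distrib]
  simp only [sum_apply, sub_apply,
    add_apply, smul_apply, smul_eq_mul]
  refine Finset.sum_congr rfl fun i _ => ?_
  rw [fderiv_fderiv_apply_comm ha (dirq i) v, fderiv_fderiv_apply_comm ha (dirp i) v,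
    fderiv_fderiv_apply_comm hb (dirq i) v, fderiv_fderiv_apply_comm hb (dirp i) v]
  ring

theorem bracketQ_eq {a b : Phase → ℝ} (ha : ContDiff ℝ (⊤ : ℕ∞) a)
    (hb : ContDiff ℝ (⊤ : ℕ∞) b) (i : Fin 3) (z : Phase) :
    bracketQ a b i z = -fderiv ℝ (poisson a b) z (dirp i) := by
  have ha' := differentiable_of_smooth ha
  have hb' := differentiable_of_smooth hb
  rw [fderiv_poisson_apply ha hb, bracketQ, Xact_coordq ha', Xact_coordq hb',
    Xact_eq_fderiv ha' (differentiable_of_smooth (contDiff_fderiv_apply_const hb _)),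
    Xact_eq_fderiv hb' (differentiable_of_smooth (contDiff_fderiv_apply_const ha _)),
    poisson, poisson, ← Finset.sum_add_distrib, ← Finset.sum_sub_distrib,
    ← Finset.sum_neg_distrib]
  exact Finset.sum_congr rfl fun j _ => by ring

theorem bracketP_eq {a b : Phase → ℝ} (ha : ContDiff ℝ (⊤ : ℕ∞) a)
    (hb : ContDiff ℝ (⊤ : ℕ∞) b) (i : Fin 3) (z : Phase) :
    bracketP a b i z = fderiv ℝ (poisson a b) z (dirq i) := by
  have ha' := differentiable_of_smooth ha
  have hb' := differentiable_of_smooth hb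
  rw [fderiv_poisson_apply ha hb, bracketP, Xact_coordp ha', Xact_coordp hb',
    Xact_eq_fderiv ha' (differentiable_of_smooth (contDiff_fderiv_apply_const hb _).neg),
    Xact_eq_fderiv hb' (differentiable_of_smooth (contDiff_fderiv_apply_const ha _).neg),
    poisson, poisson, ← Finset.sum_add_distrib, ← Finset.sum_sub_distrib]
  refine Finset.sum_congr rfl fun j _ => ?_
  simp only [fderiv_fun_neg, neg_apply]
  ring

/-- pairing a compactly supported momentum one-form `Π` with the
Jacobi–Lie bracket `[X_a, X_b]` of Hamiltonian vector fields gives the density `f`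
paired with the canonical Poisson bracket `{a, b}`:
`∫ ⟨Π, [X_a, X_b]⟩ dμ = ∫ f·{a, b} dμ`. -/
theorem pairing_with_jacobi_lie_bracket
    (a b : Phase → ℝ) (ha : ContDiff ℝ (⊤ : ℕ∞) a) (hb : ContDiff ℝ (⊤ : ℕ∞) b)
    (Pq Pp : Fin 3 → Phase → ℝ)
    (hPq : ∀ i, ContDiff ℝ (⊤ : ℕ∞) (Pq i)) (hPp : ∀ i, ContDiff ℝ (⊤ : ℕ∞) (Pp i))
    (hcq : ∀ i, HasCompactSupport (Pq i)) (hcp : ∀ i, HasCompactSupport (Pp i))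
    (f : Phase → ℝ)
    (hf : ∀ z, f z = ∑ i : Fin 3, (pp i (Pq i) z - pq i (Pp i) z)) :
    ∫ z : Phase,
        (∑ i : Fin 3, (Pq i z * bracketQ a b i z + Pp i z * bracketP a b i z))
      = ∫ z : Phase,
          f z * (∑ i : Fin 3, (pq i a z * pp i b z - pp i a z * pq i b z)) := by
  have hh := contDiff_poisson ha hb
  have hQ := fun i => integral_mul_fderiv_apply (hPq i) (hcq i) hh (dirp i)
  have hP := fun i => integral_mul_fderiv_apply (hPp i) (hcp i) hh (dirq i)
  have hL : ∀ z, (∑ i : Fin 3, (Pq i z * bracketQ a b i z + Pp i z * bracketP a b i z)) =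
      ∑ i : Fin 3, (Pp i z * fderiv ℝ (poisson a b) z (dirq i)
        - Pq i z * fderiv ℝ (poisson a b) z (dirp i)) := fun z =>
    Finset.sum_congr rfl fun i _ => by rw [bracketQ_eq ha hb, bracketP_eq ha hb]; ring
  have hR : ∀ z, f z * (∑ i : Fin 3, (pq i a z * pp i b z - pp i a z * pq i b z)) =
      ∑ i : Fin 3, (fderiv ℝ (Pq i) z (dirp i) * poisson a b z
        - fderiv ℝ (Pp i) z (dirq i) * poisson a b z) := fun z => by
    simp only [hf, poisson, Finset.sum_mul, sub_mul,
      pq_eq_fderiv (differentiable_of_smooth ha), pp_eq_fderiv (differentiable_of_smooth ha),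
      pq_eq_fderiv (differentiable_of_smooth hb), pp_eq_fderiv (differentiable_of_smooth hb),
      fun i => pp_eq_fderiv (differentiable_of_smooth (hPq i)),
      fun i => pq_eq_fderiv (differentiable_of_smooth (hPp i))]
  simp only [hL, hR]
  rw [integral_finsetSum _ fun i _ => (hP i).1.sub' (hQ i).1,
    integral_finsetSum _ fun i _ => (hQ i).2.1.sub' (hP i).2.1]
  refine Finset.sum_congr rfl fun i _ => ?_
  rw [integral_sub (hP i).1 (hQ i).1, integral_sub (hQ i).2.1 (hP i).2.1, (hP i).2.2, (hQ i).2.2]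
  ring
end
end

section
/- Let m > 0 and e be real constants, let h be any smooth function on ℝ³ × ℝ³, and let φ : ℝ³ → ℝ be smooth. For smooth functions Π_i, Πⁱ (i = 1,2,3) on ℝ³ × ℝ³, define the quadratic Hamiltonian density I(Π) = Σ_i Π_i·X_h(Πⁱ) + (1/(2m))·Σ_i Π_i² + (e/2)·Σ_{i,j} (∂²φ/∂q_i∂q_j)·Πⁱ·Πʲ. Then I is pointwise invariant under the velocity-shift-and-reflection transformation Π_i ↦ Π_i + 2m·X_h(Πⁱ), Πⁱ ↦ −Πⁱ: substituting the transformed components into I gives back I(Π) identically. -/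
open MeasureTheory

noncomputable section

theorem Xact_neg (a F : Phase → ℝ) (z : Phase) :
    Xact a (fun w => -F w) z = -Xact a F z := by
  simp only [Xact, pq, pp, deriv.fun_neg, ← Finset.sum_neg_distrib]
  exact Finset.sum_congr rfl fun i _ => by ring

/-- the quadratic Hamiltonian density
`I(Π) = Σᵢ Πᵢ X_h(Πⁱ) + (1/(2m)) Σᵢ Πᵢ² + (e/2) Σᵢⱼ (∂²φ/∂qᵢ∂qⱼ) Πⁱ Πʲ`
is pointwise invariant under the velocity-shift-and-reflection transformation
`Πᵢ ↦ Πᵢ + 2m X_h(Πⁱ)`, `Πⁱ ↦ −Πⁱ`. -/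
theorem quadratic_density_shift_reflection_invariance
    (m e : ℝ) (hm : 0 < m)
    (h : Phase → ℝ) (hh : ContDiff ℝ (⊤ : ℕ∞) h)
    (φ : V3 → ℝ) (hφ : ContDiff ℝ (⊤ : ℕ∞) φ)
    (Pq Pp : Fin 3 → Phase → ℝ)
    (hPq : ∀ i, ContDiff ℝ (⊤ : ℕ∞) (Pq i)) (hPp : ∀ i, ContDiff ℝ (⊤ : ℕ∞) (Pp i))
    (I : (Fin 3 → Phase → ℝ) → (Fin 3 → Phase → ℝ) → Phase → ℝ)
    (hI : ∀ A B z, I A B z =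
      (∑ i : Fin 3, A i z * Xact h (B i) z)
        + (1 / (2 * m)) * ∑ i : Fin 3, (A i z) ^ 2
        + (e / 2) * ∑ i : Fin 3, ∑ j : Fin 3,
            dq3 i (fun q => dq3 j φ q) z.1 * B i z * B j z) :
    ∀ z : Phase,
      I (fun i w => Pq i w + 2 * m * Xact h (Pp i) w)
        (fun i w => -(Pp i w)) z = I Pq Pp z := by
  intro z
  have hm0 : m ≠ 0 := hm.ne'
  simp only [hI, Xact_neg, mul_neg, neg_mul, neg_neg]
  congr 1
  simp only [Finset.mul_sum, ← Finset.sum_add_distrib]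
  refine Finset.sum_congr rfl fun i _ => ?_
  field_simp
  ring
end
end
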